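/- arXiv:1406.2999 — 2 statements merged into one kernel-verified Lean document; each statement's English description precedes it below -/
import Mathlib

section
/- Let p ≥ 5 be a prime. Then D^{p²}P lies in the ideal (A^{2p}, p) of ℤ_(p)[P,Q,R]; that is, there exist polynomials G, H ∈ ℤ_(p)[P,Q,R] with D^{p²}P = A^{2p}·G + p·H. -/
open MvPolynomial Finset

noncomputable section

/-- `x` lies in `ℤ_(p) ⊆ ℚ`: `p` does not divide the reduced denominator of `x`. -/
def pInt (p : ℕ) (x : ℚ) : Prop := ¬ p ∣ x.den

/-- The polynomial ring `ℚ[P,Q,R]`, with `P = X 0`, `Q = X 1`, `R = X 2`. -/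
abbrev Poly3 : Type := MvPolynomial (Fin 3) ℚ

/-- `f` has all of its coefficients in `ℤ_(p)`. -/
def polyPInt (p : ℕ) (f : Poly3) : Prop := ∀ m : Fin 3 →₀ ℕ, pInt p (coeff m f)

/-- `f` is isobaric of weight `w`, where `P, Q, R` have weights `2, 4, 6`. -/
def Isobaric (w : ℕ) (f : Poly3) : Prop :=
  ∀ m ∈ f.support, 2 * m 0 + 4 * m 1 + 6 * m 2 = w

/-- `f` does not involve the variable `P`. -/
def NoP (f : Poly3) : Prop := ∀ m ∈ f.support, m 0 = 0

/-- The Ramanujan derivation `D` on `ℚ[P,Q,R]`, the unique derivation with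
`DP = (P²-Q)/12`, `DQ = (PQ-R)/3`, `DR = (PR-Q²)/2`. -/
def Dop (f : Poly3) : Poly3 :=
  C (1/12 : ℚ) * (X 0 ^ 2 - X 1) * pderiv 0 f
    + C (1/3 : ℚ) * (X 0 * X 1 - X 2) * pderiv 1 f
    + C (1/2 : ℚ) * (X 0 * X 2 - X 1 ^ 2) * pderiv 2 f

/-- The sum of the `j`-th powers of the divisors of `n`, as a rational number. -/
def sigmaQ (j n : ℕ) : ℚ := ∑ d ∈ n.divisors, (d : ℚ) ^ j

/-- The q-expansion of `E₂`. -/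
def E2s : PowerSeries ℚ := PowerSeries.mk fun n => if n = 0 then 1 else -24 * sigmaQ 1 n

/-- The q-expansion of `E₄`. -/
def E4s : PowerSeries ℚ := PowerSeries.mk fun n => if n = 0 then 1 else 240 * sigmaQ 3 n

/-- The q-expansion of `E₆`. -/
def E6s : PowerSeries ℚ := PowerSeries.mk fun n => if n = 0 then 1 else -504 * sigmaQ 5 n

/-- The q-expansion of the normalized Eisenstein series `E_{p-1}`. -/
def EAs (p : ℕ) : PowerSeries ℚ :=
  PowerSeries.mk fun n => if n = 0 then 1 else
    -(2 * ((p : ℚ) - 1) / bernoulli (p - 1)) * sigmaQ (p - 2) n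

/-- The q-expansion of the normalized Eisenstein series `E_{p+1}`. -/
def EBs (p : ℕ) : PowerSeries ℚ :=
  PowerSeries.mk fun n => if n = 0 then 1 else
    -(2 * ((p : ℚ) + 1) / bernoulli (p + 1)) * sigmaQ p n

/-- `Φ : ℚ[P,Q,R] → ℚ[[q]]`, the algebra map sending `P, Q, R` to `E₂, E₄, E₆`. -/
def Phi : Poly3 →ₐ[ℚ] PowerSeries ℚ := aeval ![E2s, E4s, E6s]

/-- The theta operator attached to the polynomials `A` and `B`:
`θf = ((BQ-AR)/3)·∂f/∂Q + ((BR-AQ²)/2)·∂f/∂R`. -/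
def thetaOp (A B f : Poly3) : Poly3 :=
  C (1/3 : ℚ) * (B * X 1 - A * X 2) * pderiv 1 f
    + C (1/2 : ℚ) * (B * X 2 - A * X 1 ^ 2) * pderiv 2 f

/-- `f` lies in the `n`-th power of the ideal `(A^p, p)` of `ℤ_(p)[P,Q,R]`. -/
def InIdealPow (p : ℕ) (A : Poly3) (n : ℕ) (f : Poly3) : Prop :=
  ∃ G : ℕ → Poly3, (∀ i, polyPInt p (G i)) ∧
    f = ∑ i ∈ Finset.range (n + 1), (p : Poly3) ^ (n - i) * A ^ (p * i) * G i

section RamanujanAnalytic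

open UpperHalfPlane Function ModularForm Derivative
open scoped Manifold MatrixGroups ModularForm Topology

/-- Functions on the upper half plane with a `q`-expansion. -/
structure NiceQ (f : ℍ → ℂ) : Prop where
  per : Periodic (f ∘ ofComplex) (1 : ℝ)
  hol : MDiff f
  bdd : IsBoundedAtImInfty f

lemma NiceQ.an {f : ℍ → ℂ} (hf : NiceQ f) : AnalyticAt ℂ (cuspFunction 1 f) 0 :=
  analyticAt_cuspFunction_zero one_pos hf.per hf.hol hf.bdd

lemma NiceQ.add {f g : ℍ → ℂ} (hf : NiceQ f) (hg : NiceQ g) : NiceQ (f + g) :=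
  ⟨hf.per.add hg.per, hf.hol.add hg.hol, hf.bdd.add hg.bdd⟩

lemma NiceQ.mul {f g : ℍ → ℂ} (hf : NiceQ f) (hg : NiceQ g) : NiceQ (f * g) :=
  ⟨hf.per.mul hg.per, hf.hol.mul hg.hol, hf.bdd.mul hg.bdd⟩

lemma NiceQ.smul {f : ℍ → ℂ} (c : ℂ) (hf : NiceQ f) : NiceQ (c • f) :=
  ⟨fun z => by simpa using congrArg (c * ·) (hf.per z), hf.hol.const_smul c, hf.bdd.smul c⟩

/-- the theta operator on power series -/
def thetaPS {K : Type*} [CommRing K] (f : PowerSeries K) : PowerSeries K :=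
  PowerSeries.mk fun n => (n : K) * PowerSeries.coeff n f

lemma niceQ_of_hasSum {f : ℍ → ℂ} (c : ℕ → ℂ) (hol : MDiff f)
    (h : ∀ τ : ℍ, HasSum (fun m ↦ c m • Periodic.qParam 1 τ ^ m) (f τ)) :
    NiceQ f ∧ qExpansion 1 f = PowerSeries.mk c := by
  have hn : NiceQ f := by
    refine ⟨?_, hol, isBoundedAtImInfty_of_hasSum_qExpansion one_pos h⟩
    intro w
    by_cases hw : 0 < w.im
    · have hw' : 0 < (w + (1 : ℝ)).im := by simpa using hw
      simp only [comp_apply]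
      have h1 := h (ofComplex w)
      have h2 := h (ofComplex (w + (1 : ℝ)))
      rw [ofComplex_apply_of_im_pos hw] at h1 ⊢
      rw [ofComplex_apply_of_im_pos hw'] at h2 ⊢
      have hqq : Periodic.qParam 1 (w + (1 : ℝ)) = Periodic.qParam 1 w := by
        unfold Periodic.qParam
        rw [← Complex.exp_periodic (2 * Real.pi * Complex.I * w / (1 : ℝ))]
        congr 1
        push_cast
        ring
      refine h2.unique ?_
      simp only [hqq]
      exact h1
    · have hw' : ¬ 0 < (w + (1 : ℝ)).im := by simpa using hw
      simp only [comp_apply]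
      rw [ofComplex_apply_of_im_nonpos (not_lt.mp hw), ofComplex_apply_of_im_nonpos (not_lt.mp hw')]
  refine ⟨hn, ?_⟩
  ext m
  rw [PowerSeries.coeff_mk]
  have h1 := (hasFPowerSeriesOnBall_cuspFunction one_pos hn.an h).hasFPowerSeriesAt
  have h2 := (hasFPowerSeriesOnBall_cuspFunction one_pos hn.an
    (hasSum_qExpansion one_pos hn.per hn.hol hn.bdd)).hasFPowerSeriesAt
  simpa using congr_arg (FormalMultilinearSeries.coeff · m) (h2.eq_formalMultilinearSeries h1)

lemma niceQ_D {f : ℍ → ℂ} (hf : NiceQ f) :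
    NiceQ (normalizedDerivOfComplex f) ∧
      qExpansion 1 (normalizedDerivOfComplex f) = thetaPS (qExpansion 1 f) := by
  refine niceQ_of_hasSum _ (normalizedDerivOfComplex_mdifferentiable hf.hol) ?_
  intro τ
  set g := cuspFunction 1 f with hg
  have hgd : DifferentiableOn ℂ g (Metric.ball 0 1) :=
    differentiableOn_cuspFunction_ball one_pos hf.per hf.hol hf.bdd
  have hq : ‖Periodic.qParam 1 τ‖ < 1 := Periodic.norm_qParam_lt_one one_pos τ.im_pos
  set q := Periodic.qParam 1 τ with hqdef
  have hsum := Complex.hasSum_taylorSeries_on_ball (hgd.deriv Metric.isOpen_ball)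
    (z := q) (by simpa using hq)
  have hval : normalizedDerivOfComplex f τ = q * deriv g q := by
    unfold normalizedDerivOfComplex
    have hev : f ∘ ofComplex =ᶠ[𝓝 (τ : ℂ)] fun w => g (Periodic.qParam 1 w) := by
      filter_upwards [isOpen_upperHalfPlaneSet.mem_nhds τ.im_pos] with w hw
      have := eq_cuspFunction (f := f) ⟨w, hw⟩ one_ne_zero hf.per
      simp only [comp_apply, ofComplex_apply_of_im_pos hw]
      exact this.symm
    rw [hev.deriv_eq]
    have hd1 : HasDerivAt g (deriv g q) q :=
      ((hgd.differentiableAt (Metric.isOpen_ball.mem_nhds (by simpa using hq)))).hasDerivAt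
    have hd2 : HasDerivAt (fun w : ℂ => Periodic.qParam 1 w) (q * (2 * Real.pi * Complex.I)) τ := by
      have := ((hasDerivAt_id (τ : ℂ)).const_mul (2 * Real.pi * Complex.I)).cexp
      simpa [Periodic.qParam, hqdef] using this
    have := (hd1.comp (τ : ℂ) hd2).deriv
    simp only [comp_def] at this
    rw [this]
    have : (2 * Real.pi * Complex.I : ℂ) ≠ 0 := Complex.two_pi_I_ne_zero
    field_simp
  rw [hval, ← hasSum_nat_add_iff' 1]
  simp only [Finset.range_one, Finset.sum_singleton]
  convert! hsum.mul_left q using 1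
  · ext m
    simp only [qExpansion_coeff, ← hg, iteratedDeriv_succ', Nat.factorial_succ, smul_eq_mul,
      sub_zero]
    have : ((m : ℂ) + 1) ≠ 0 := by exact_mod_cast Nat.succ_ne_zero m
    push_cast
    field_simp
    ring
  · simp

lemma sturm_aux {f : ℍ → ℂ} (k : ℕ) (hk : k < 12) (hf : NiceQ f)
    (hs : ∀ γ : SL(2, ℤ), f ∣[(k : ℤ)] γ = f) (h0 : (qExpansion 1 f).coeff 0 = 0) :
    qExpansion 1 f = 0 := by
  let F : ModularForm 𝒮ℒ (k : ℤ) :=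
    { toFun := f
      slash_action_eq' := fun _ ⟨γ, hγ⟩ ↦ hγ ▸ hs γ
      holo' := hf.hol
      bdd_at_cusps' {c} hc := by
        rw [OnePoint.isBoundedAt_iff_forall_SL2Z hc]
        intro γ _
        rw [hs γ]
        exact hf.bdd }
  have hF : F = 0 := by
    apply ModularForm.sturm_bound_levelOne_nat
    rw [Nat.div_eq_of_lt hk]
    rw [Nat.cast_zero, pos_iff_ne_zero, Ne, ← Ne, PowerSeries.order_ne_zero_iff_constCoeff_eq_zero,
      ← PowerSeries.coeff_zero_eq_constantCoeff_apply]
    exact h0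
  have : f = 0 := by
    have := congrArg (fun G : ModularForm 𝒮ℒ (k : ℤ) => (G : ℍ → ℂ)) hF
    exact this
  rw [this, qExpansion_zero]

open EisensteinSeries in
lemma E2_slash_aux (γ : SL(2, ℤ)) (z : ℍ) :
    (E2 ∣[(2 : ℤ)] γ) z = E2 z + 12 * ((2 * Real.pi * Complex.I)⁻¹ * (γ 1 0 / denom γ z)) := by
  rw [E2_slash_action]
  simp only [Pi.sub_apply, Pi.smul_apply, D2, riemannZeta_two, smul_eq_mul]
  have h1 : (Real.pi : ℂ) ≠ 0 := by exact_mod_cast Real.pi_ne_zero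
  have h2 : denom γ z ≠ 0 := denom_ne_zero γ z
  field_simp
  linear_combination (-12 * (γ 1 0 : ℂ)) * Complex.I_sq

open EisensteinSeries in
lemma E2_niceQ : NiceQ E2 ∧ qExpansion 1 E2 =
    PowerSeries.mk fun m => (if m = 0 then 1 else -24 * (ArithmeticFunction.sigma 1 m : ℂ)) := by
  refine niceQ_of_hasSum _ E2_mdifferentiable fun τ => ?_
  simpa only [Function.Periodic.qParam, Complex.ofReal_one, div_one]
    using hasSum_qExpansion_E2 (z := τ)

lemma modform_niceQ {k : ℤ} (f : ModularForm 𝒮ℒ k) : NiceQ f :=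
  ⟨SlashInvariantFormClass.periodic_comp_ofComplex f one_mem_strictPeriods_SL,
    f.holo', ModularFormClass.bdd_at_infty f⟩

lemma modform_slash {k : ℤ} (f : ModularForm 𝒮ℒ k) (γ : SL(2, ℤ)) : (f : ℍ → ℂ) ∣[k] γ = f :=
  f.slash_action_eq' _ ⟨γ, rfl⟩

open EisensteinSeries in
lemma DE2_slash (γ : SL(2, ℤ)) (z : ℍ) :
    (normalizedDerivOfComplex E2 ∣[(4 : ℤ)] γ) z = normalizedDerivOfComplex E2 z
      + 2 * ((2 * Real.pi * Complex.I)⁻¹ * (γ 1 0 / denom γ z)) * E2 z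
      + 12 * ((2 * Real.pi * Complex.I)⁻¹ * (γ 1 0 / denom γ z)) ^ 2 := by
  have h := congrFun (normalizedDerivOfComplex_SL_slash (k := 2) E2_mdifferentiable (γ := γ)) z
  simp only [Pi.sub_apply] at h
  have h4 : (2 : ℤ) + 2 = 4 := by norm_num
  rw [h4, E2_slash_aux] at h
  have hD : normalizedDerivOfComplex (E2 ∣[(2 : ℤ)] γ) z = normalizedDerivOfComplex E2 z
      - 12 * ((2 * Real.pi * Complex.I)⁻¹ * (γ 1 0 / denom γ z)) ^ 2 := by
    unfold normalizedDerivOfComplex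
    have hev : (E2 ∣[(2 : ℤ)] γ) ∘ ofComplex =ᶠ[𝓝 (z : ℂ)] fun w => (E2 ∘ ofComplex) w +
        12 * ((2 * Real.pi * Complex.I)⁻¹ * (γ 1 0 * (denom γ w) ^ (-1 : ℤ))) := by
      filter_upwards [isOpen_upperHalfPlaneSet.mem_nhds z.im_pos] with w hw
      simp only [comp_apply, ofComplex_apply_of_im_pos hw, E2_slash_aux, zpow_neg_one, div_eq_mul_inv]
    rw [hev.deriv_eq]
    have hd1 : HasDerivAt (E2 ∘ ofComplex) (deriv (E2 ∘ ofComplex) z) z :=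
      (mdifferentiableAt_iff.mp (E2_mdifferentiable z)).hasDerivAt
    have hd2 := ((((hasDerivAt_denom_zpow (γ : GL (Fin 2) ℝ) (-1) z).const_mul
      (γ 1 0 : ℂ)).const_mul ((2 * Real.pi * Complex.I : ℂ)⁻¹)).const_mul 12)
    rw [(HasDerivAt.fun_add hd1 hd2).deriv]
    have h2 : denom γ z ≠ 0 := denom_ne_zero γ z
    have e1 : (-1 - 1 : ℤ) = -2 := by norm_num
    rw [e1, zpow_neg]
    simp only [Int.reduceNeg, Int.cast_neg, Int.cast_one]
    norm_cast
    simp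
    field_simp
    ring
  rw [hD] at h
  push_cast at h
  linear_combination -h

lemma thetaPS_coeff_zero {K : Type*} [CommRing K] (f : PowerSeries K) :
    PowerSeries.constantCoeff (thetaPS f) = 0 := by
  rw [← PowerSeries.coeff_zero_eq_constantCoeff_apply]
  simp [thetaPS]

open EisensteinSeries in
lemma raman_E2 : (12 : ℂ) • thetaPS (qExpansion 1 E2) =
    qExpansion 1 E2 * qExpansion 1 E2 - qExpansion 1 E₄ := by
  obtain ⟨n2, q2⟩ := E2_niceQ
  obtain ⟨nd, qd⟩ := niceQ_D n2
  have n4 := modform_niceQ E₄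
  have a1 := nd.smul 12
  have a2 := (n2.mul n2).smul (-1)
  have key := sturm_aux 4 (by norm_num) ((a1.add a2).add n4) ?_ ?_
  · rw [qExpansion_add (a1.add a2).an n4.an, qExpansion_add a1.an a2.an, qExpansion_smul nd.an,
      qExpansion_smul (n2.mul n2).an, qExpansion_mul n2.an n2.an, qd] at key
    linear_combination key - (by simp : (-1 : ℂ) • (qExpansion 1 E2 * qExpansion 1 E2)
      = - (qExpansion 1 E2 * qExpansion 1 E2))
  · intro γ
    ext z
    have e4 := modform_slash E₄ γ
    have h22 := ModularForm.mul_slash_SL2 2 2 γ E2 E2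
    have h24 : (2 : ℤ) + 2 = 4 := by norm_num
    rw [h24] at h22
    simp only [Nat.cast_ofNat, SlashAction.add_slash, ModularForm.SL_smul_slash, h22, e4]
    simp only [Pi.add_apply, Pi.smul_apply, Pi.mul_apply, DE2_slash, E2_slash_aux, smul_eq_mul]
    ring
  · rw [qExpansion_add (a1.add a2).an n4.an, qExpansion_add a1.an a2.an, qExpansion_smul nd.an,
      qExpansion_smul (n2.mul n2).an, qExpansion_mul n2.an n2.an, qd, q2]
    have := E_qExpansion_coeff_zero (k := 4) (by norm_num) (by decide)
    simp [thetaPS_coeff_zero] at this ⊢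
    simp [this, ← PowerSeries.coeff_zero_eq_constantCoeff_apply]

open EisensteinSeries in
lemma raman_E4 : (3 : ℂ) • thetaPS (qExpansion 1 E₄) =
    qExpansion 1 E2 * qExpansion 1 E₄ - qExpansion 1 E₆ := by
  obtain ⟨n2, q2⟩ := E2_niceQ
  have n4 := modform_niceQ E₄
  have n6 := modform_niceQ E₆
  obtain ⟨nd, qd⟩ := niceQ_D n4
  have a1 := nd.smul 3
  have a2 := (n2.mul n4).smul (-1)
  have key := sturm_aux 6 (by norm_num) ((a1.add a2).add n6) ?_ ?_
  · rw [qExpansion_add (a1.add a2).an n6.an, qExpansion_add a1.an a2.an, qExpansion_smul nd.an,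
      qExpansion_smul (n2.mul n4).an, qExpansion_mul n2.an n4.an, qd] at key
    linear_combination key - (by simp : (-1 : ℂ) • (qExpansion 1 E2 * qExpansion 1 E₄)
      = - (qExpansion 1 E2 * qExpansion 1 E₄))
  · intro γ
    have e6 := modform_slash E₆ γ
    have hs := serreDerivative_slash_invariant (γ := γ) n4.hol (modform_slash E₄ γ)
    have h24 : (4 : ℤ) + 2 = 6 := by norm_num
    rw [h24] at hs
    have hh : (3 : ℂ) • normalizedDerivOfComplex (⇑E₄) + (-1 : ℂ) • (E2 * ⇑E₄) =
        (3 : ℂ) • serreDerivative (4 : ℤ) (⇑E₄) := by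
      ext z
      simp
      ring
    rw [hh]
    simp only [Nat.cast_ofNat, SlashAction.add_slash, ModularForm.SL_smul_slash, hs, e6]
  · rw [qExpansion_add (a1.add a2).an n6.an, qExpansion_add a1.an a2.an, qExpansion_smul nd.an,
      qExpansion_smul (n2.mul n4).an, qExpansion_mul n2.an n4.an, qd, q2]
    have := E_qExpansion_coeff_zero (k := 4) (by norm_num) (by decide)
    have h6 := E_qExpansion_coeff_zero (k := 6) (by norm_num) (by decide)
    simp [thetaPS_coeff_zero] at this h6 ⊢
    simp [this, h6, ← PowerSeries.coeff_zero_eq_constantCoeff_apply]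

open EisensteinSeries in
lemma raman_E6 : (2 : ℂ) • thetaPS (qExpansion 1 E₆) =
    qExpansion 1 E2 * qExpansion 1 E₆ - qExpansion 1 E₄ * qExpansion 1 E₄ := by
  obtain ⟨n2, q2⟩ := E2_niceQ
  have n4 := modform_niceQ E₄
  have n6 := modform_niceQ E₆
  obtain ⟨nd, qd⟩ := niceQ_D n6
  have a1 := nd.smul 2
  have a2 := (n2.mul n6).smul (-1)
  have a3 := n4.mul n4
  have key := sturm_aux 8 (by norm_num) ((a1.add a2).add a3) ?_ ?_
  · rw [qExpansion_add (a1.add a2).an a3.an, qExpansion_add a1.an a2.an, qExpansion_smul nd.an,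
      qExpansion_smul (n2.mul n6).an, qExpansion_mul n2.an n6.an, qExpansion_mul n4.an n4.an,
      qd] at key
    linear_combination key - (by simp : (-1 : ℂ) • (qExpansion 1 E2 * qExpansion 1 E₆)
      = - (qExpansion 1 E2 * qExpansion 1 E₆))
  · intro γ
    have e44 := ModularForm.mul_slash_SL2 4 4 γ E₄ E₄
    have h44 : (4 : ℤ) + 4 = 8 := by norm_num
    rw [modform_slash E₄ γ, h44] at e44
    have hs := serreDerivative_slash_invariant (γ := γ) n6.hol (modform_slash E₆ γ)
    have h24 : (6 : ℤ) + 2 = 8 := by norm_num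
    rw [h24] at hs
    have hh : (2 : ℂ) • normalizedDerivOfComplex (⇑E₆) + (-1 : ℂ) • (E2 * ⇑E₆) =
        (2 : ℂ) • serreDerivative (6 : ℤ) (⇑E₆) := by
      ext z
      simp
      ring
    rw [hh]
    simp only [Nat.cast_ofNat, SlashAction.add_slash, ModularForm.SL_smul_slash, hs, e44]
  · rw [qExpansion_add (a1.add a2).an a3.an, qExpansion_add a1.an a2.an, qExpansion_smul nd.an,
      qExpansion_smul (n2.mul n6).an, qExpansion_mul n2.an n6.an, qExpansion_mul n4.an n4.an,
      qd, q2]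
    have := E_qExpansion_coeff_zero (k := 4) (by norm_num) (by decide)
    have h6 := E_qExpansion_coeff_zero (k := 6) (by norm_num) (by decide)
    simp [thetaPS_coeff_zero] at this h6 ⊢
    simp [this, h6, ← PowerSeries.coeff_zero_eq_constantCoeff_apply]

end RamanujanAnalytic

/-- Eisenstein-type series over an arbitrary ring. -/
def ES (K : Type*) [CommRing K] (c : ℤ) (j : ℕ) : PowerSeries K :=
  PowerSeries.mk fun n => if n = 0 then 1 else (c : K) * ((ArithmeticFunction.sigma j n : ℕ) : K)

lemma ES_map {K L : Type*} [CommRing K] [CommRing L] (g : K →+* L) (c : ℤ) (j : ℕ) :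
    PowerSeries.map g (ES K c j) = ES L c j := by
  ext n
  simp only [ES, PowerSeries.coeff_map, PowerSeries.coeff_mk]
  split_ifs <;> simp

lemma thetaPS_eq {K : Type*} [CommRing K] (f : PowerSeries K) :
    thetaPS f = PowerSeries.X * PowerSeries.derivative K f := by
  ext n
  cases n with
  | zero => simp [thetaPS]
  | succ n => simp [thetaPS, PowerSeries.coeff_succ_X_mul, PowerSeries.coeff_derivative, mul_comm]

lemma thetaPS_add {K : Type*} [CommRing K] (f g : PowerSeries K) :
    thetaPS (f + g) = thetaPS f + thetaPS g := by
  simp [thetaPS_eq, mul_add]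

lemma thetaPS_mul {K : Type*} [CommRing K] (f g : PowerSeries K) :
    thetaPS (f * g) = thetaPS f * g + f * thetaPS g := by
  simp [thetaPS_eq, Derivation.leibniz]
  ring

lemma thetaPS_map {K L : Type*} [CommRing K] [CommRing L] (g : K →+* L) (f : PowerSeries K) :
    PowerSeries.map g (thetaPS f) = thetaPS (PowerSeries.map g f) := by
  ext n
  simp [thetaPS]

lemma thetaPS_iter_coeff {K : Type*} [CommRing K] (f : PowerSeries K) (k n : ℕ) :
    PowerSeries.coeff n (thetaPS^[k] f) = (n : K) ^ k * PowerSeries.coeff n f := by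
  induction k with
  | zero => simp
  | succ k ih =>
    rw [Function.iterate_succ_apply', thetaPS, PowerSeries.coeff_mk, ih]
    ring

lemma bern4 : bernoulli 4 = -1/30 := by
  rw [bernoulli_eq_bernoulli'_of_ne_one (by norm_num), bernoulli'_four]

lemma bern5 : bernoulli' 5 = 0 := by
  have h := bernoulli'_eq_zero_of_odd (n := 5) (by decide) (by norm_num)
  exact h

lemma bern6 : bernoulli 6 = 1/42 := by
  rw [bernoulli_eq_bernoulli'_of_ne_one (by norm_num), bernoulli'_def]
  simp only [Finset.sum_range_succ, Finset.sum_range_zero, bern5, bernoulli'_four,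
    bernoulli'_three, bernoulli'_two, bernoulli'_one, bernoulli'_zero]
  norm_num [Nat.choose]

section
open UpperHalfPlane ModularForm EisensteinSeries

lemma qE2 : qExpansion 1 E2 = ES ℂ (-24) 1 := by
  rw [E2_niceQ.2]
  ext n
  simp [ES]

lemma qE4 : qExpansion 1 E₄ = ES ℂ 240 3 := by
  ext n
  rw [E_qExpansion_coeff (by norm_num) (by decide)]
  simp only [ES, PowerSeries.coeff_mk, bern4]
  split_ifs
  · rfl
  · push_cast; norm_num

lemma qE6 : qExpansion 1 E₆ = ES ℂ (-504) 5 := by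
  ext n
  rw [E_qExpansion_coeff (by norm_num) (by decide)]
  simp only [ES, PowerSeries.coeff_mk, bern6]
  split_ifs
  · rfl
  · push_cast; norm_num

lemma ramanC : (12 * thetaPS (ES ℂ (-24) 1) = ES ℂ (-24) 1 * ES ℂ (-24) 1 - ES ℂ 240 3) ∧
    (3 * thetaPS (ES ℂ 240 3) = ES ℂ (-24) 1 * ES ℂ 240 3 - ES ℂ (-504) 5) ∧
    (2 * thetaPS (ES ℂ (-504) 5) = ES ℂ (-24) 1 * ES ℂ (-504) 5 - ES ℂ 240 3 * ES ℂ 240 3) := by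
  have h2 := raman_E2
  have h4 := raman_E4
  have h6 := raman_E6
  rw [qE2, qE4] at h2
  rw [qE2, qE4, qE6] at h4
  rw [qE2, qE4, qE6] at h6
  refine ⟨?_, ?_, ?_⟩
  · rw [← h2, PowerSeries.smul_eq_C_mul, map_ofNat]
  · rw [← h4, PowerSeries.smul_eq_C_mul, map_ofNat]
  · rw [← h6, PowerSeries.smul_eq_C_mul, map_ofNat]

end

lemma ramanZ : (12 * thetaPS (ES ℤ (-24) 1) = ES ℤ (-24) 1 * ES ℤ (-24) 1 - ES ℤ 240 3) ∧
    (3 * thetaPS (ES ℤ 240 3) = ES ℤ (-24) 1 * ES ℤ 240 3 - ES ℤ (-504) 5) ∧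
    (2 * thetaPS (ES ℤ (-504) 5) = ES ℤ (-24) 1 * ES ℤ (-504) 5 - ES ℤ 240 3 * ES ℤ 240 3) := by
  have hinj : Function.Injective (PowerSeries.map (Int.castRingHom ℂ)) :=
    PowerSeries.map_injective _ (RingHom.injective_int _)
  obtain ⟨h2, h4, h6⟩ := ramanC
  refine ⟨hinj ?_, hinj ?_, hinj ?_⟩
  · simpa only [map_mul, map_sub, map_ofNat, thetaPS_map, ES_map] using h2
  · simpa only [map_mul, map_sub, map_ofNat, thetaPS_map, ES_map] using h4
  · simpa only [map_mul, map_sub, map_ofNat, thetaPS_map, ES_map] using h6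

lemma ramanK (K : Type*) [CommRing K] :
    (12 * thetaPS (ES K (-24) 1) = ES K (-24) 1 * ES K (-24) 1 - ES K 240 3) ∧
    (3 * thetaPS (ES K 240 3) = ES K (-24) 1 * ES K 240 3 - ES K (-504) 5) ∧
    (2 * thetaPS (ES K (-504) 5) = ES K (-24) 1 * ES K (-504) 5 - ES K 240 3 * ES K 240 3) := by
  obtain ⟨h2, h4, h6⟩ := ramanZ
  have g2 := congrArg (PowerSeries.map (Int.castRingHom K)) h2
  have g4 := congrArg (PowerSeries.map (Int.castRingHom K)) h4
  have g6 := congrArg (PowerSeries.map (Int.castRingHom K)) h6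
  simp only [map_mul, map_sub, map_ofNat, thetaPS_map, ES_map] at g2 g4 g6
  exact ⟨g2, g4, g6⟩

/-- The Ramanujan derivation over a ring in which `12 * t = 1`. -/
def DK {K : Type*} [CommRing K] (t : K) (f : MvPolynomial (Fin 3) K) : MvPolynomial (Fin 3) K :=
  C t * (X 0 ^ 2 - X 1) * pderiv 0 f
    + C (4 * t) * (X 0 * X 1 - X 2) * pderiv 1 f
    + C (6 * t) * (X 0 * X 2 - X 1 ^ 2) * pderiv 2 f

/-- The q-expansion map over a ring `K`. -/
def PhiK (K : Type*) [CommRing K] : MvPolynomial (Fin 3) K →ₐ[K] PowerSeries K :=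
  aeval ![ES K (-24) 1, ES K 240 3, ES K (-504) 5]

lemma DK_add {K : Type*} [CommRing K] (t : K) (f g : MvPolynomial (Fin 3) K) :
    DK t (f + g) = DK t f + DK t g := by
  simp only [DK, map_add]; ring

lemma DK_mul {K : Type*} [CommRing K] (t : K) (f g : MvPolynomial (Fin 3) K) :
    DK t (f * g) = DK t f * g + f * DK t g := by
  simp only [DK, Derivation.leibniz, smul_eq_mul]; ring

lemma DK_C {K : Type*} [CommRing K] (t a : K) : DK t (C a) = 0 := by
  simp [DK]

lemma DK_map {K L : Type*} [CommRing K] [CommRing L] (g : K →+* L) (t : K)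
    (f : MvPolynomial (Fin 3) K) : map g (DK t f) = DK (g t) (map g f) := by
  simp only [DK, pderiv_map, map_add, map_mul, map_sub, map_pow, map_X, map_C, map_ofNat]

lemma DK_iter_map {K L : Type*} [CommRing K] [CommRing L] (g : K →+* L) (t : K) (n : ℕ)
    (f : MvPolynomial (Fin 3) K) : map g ((DK t)^[n] f) = (DK (g t))^[n] (map g f) := by
  induction n with
  | zero => rfl
  | succ n ih => rw [Function.iterate_succ_apply', DK_map, ih, Function.iterate_succ_apply']

lemma Dop_eq : Dop = DK (1 / 12 : ℚ) := by
  funext f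
  simp only [Dop, DK]
  norm_num

lemma PhiK_map {K L : Type*} [CommRing K] [CommRing L] (g : K →+* L)
    (f : MvPolynomial (Fin 3) K) : PowerSeries.map g (PhiK K f) = PhiK L (map g f) := by
  induction f using MvPolynomial.induction_on with
  | C a => 
    rw [map_C]
    simp only [PhiK, algHom_C]
    ext n
    simp [PowerSeries.coeff_C]
  | add f g h1 h2 => simp only [map_add, h1, h2]
  | mul_X f i h => 
    simp only [map_mul, h, map_X]
    congr 1
    fin_cases i <;> simp [PhiK, ES_map]

lemma PhiK_D {K : Type*} [CommRing K] (t : K) (ht : 12 * t = 1) (f : MvPolynomial (Fin 3) K) :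
    PhiK K (DK t f) = thetaPS (PhiK K f) := by
  obtain ⟨h2, h4, h6⟩ := ramanK K
  have hC : (PowerSeries.C t : PowerSeries K) * 12 = 1 := by
    have := congrArg (PowerSeries.C (R := K)) ht
    rw [map_mul, map_ofNat, map_one] at this
    linear_combination this
  induction f using MvPolynomial.induction_on with
  | C a => 
    rw [DK_C]
    simp only [PhiK, algHom_C, map_zero]
    ext n
    simp [PowerSeries.algebraMap_apply, thetaPS, PowerSeries.coeff_C]
    intro hn
    simp [hn]
  | add f g h1 h2 => simp only [map_add, DK_add, thetaPS_add, h1, h2]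
  | mul_X f i h => 
    have hX : PhiK K (DK t (X i)) = thetaPS (PhiK K (X i)) := by
      have e (a : K) : PhiK K (C a) = PowerSeries.C a := by simp [PhiK, PowerSeries.algebraMap_apply]
      have e0 : PhiK K (X 0) = ES K (-24) 1 := by simp [PhiK]
      have e1 : PhiK K (X 1) = ES K 240 3 := by simp [PhiK]
      have e2 : PhiK K (X 2) = ES K (-504) 5 := by simp [PhiK]
      fin_cases i
      · simp [DK, pderiv_X, e, e0, e1, e2, map_ofNat (PowerSeries.C (R := K))]
        linear_combination (-PowerSeries.C t) * h2 + thetaPS (ES K (-24) 1) * hC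
      · simp [DK, pderiv_X, e, e0, e1, e2, map_ofNat (PowerSeries.C (R := K))]
        linear_combination (-4 * PowerSeries.C t) * h4 + thetaPS (ES K 240 3) * hC
      · simp [DK, pderiv_X, e, e0, e1, e2, map_ofNat (PowerSeries.C (R := K))]
        linear_combination (-6 * PowerSeries.C t) * h6 + thetaPS (ES K (-504) 5) * hC
    rw [DK_mul, map_add, map_mul, map_mul, map_mul, thetaPS_mul, hX, h]

lemma PhiK_D_iter {K : Type*} [CommRing K] (t : K) (ht : 12 * t = 1) (n : ℕ)
    (f : MvPolynomial (Fin 3) K) : PhiK K ((DK t)^[n] f) = thetaPS^[n] (PhiK K f) := by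
  induction n with
  | zero => rfl
  | succ n ih => rw [Function.iterate_succ_apply', PhiK_D t ht, ih, Function.iterate_succ_apply']

lemma Phi_eq (f : Poly3) : Phi f = PhiK ℚ f := by
  have h (c : ℤ) (j : ℕ) : (PowerSeries.mk fun n => if n = 0 then (1:ℚ) else c * sigmaQ j n) =
      ES ℚ c j := by
    ext n
    simp [ES, sigmaQ, ArithmeticFunction.sigma_apply]
  have h2 := h (-24) 1
  have h4 := h 240 3
  have h6 := h (-504) 5
  push_cast at h2 h4 h6
  rw [Phi, PhiK, E2s, E4s, E6s, h2, h4, h6]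

/-- The weights of the three variables. -/
def wt3 : Fin 3 → ℕ := ![2, 4, 6]

lemma wt3_apply (m : Fin 3 →₀ ℕ) : Finsupp.weight wt3 m = 2 * m 0 + 4 * m 1 + 6 * m 2 := by
  rw [Finsupp.weight_apply, Finsupp.sum_fintype _ _ (by simp)]
  simp [Fin.sum_univ_three, wt3]
  ring

lemma hom_mul_pderiv {K : Type*} [CommRing K] {f q : MvPolynomial (Fin 3) K} {w : ℕ} {i : Fin 3}
    (hf : IsWeightedHomogeneous wt3 f w) (hq : IsWeightedHomogeneous wt3 q (wt3 i + 2)) :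
    IsWeightedHomogeneous wt3 (q * pderiv i f) (w + 2) := by
  by_cases h : wt3 i ≤ w
  · have := hq.mul (hf.pderiv (n' := w - wt3 i) (i := i) (by omega))
    have e : wt3 i + 2 + (w - wt3 i) = w + 2 := by omega
    rwa [e] at this
  · have h0 : pderiv i f = 0 := by
      ext m
      rw [coeff_pderiv, coeff_zero]
      by_contra hc
      have h1 := hf (left_ne_zero_of_mul hc)
      rw [map_add, Finsupp.weight_single] at h1
      simp at h1
      omega
    rw [h0, mul_zero]
    exact isWeightedHomogeneous_zero _ _ _

lemma DK_hom {K : Type*} [CommRing K] (t : K) {f : MvPolynomial (Fin 3) K} {w : ℕ}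
    (hf : IsWeightedHomogeneous wt3 f w) : IsWeightedHomogeneous wt3 (DK t f) (w + 2) := by
  have x0 : IsWeightedHomogeneous wt3 (X 0 : MvPolynomial (Fin 3) K) 2 :=
    isWeightedHomogeneous_X K wt3 0
  have x1 : IsWeightedHomogeneous wt3 (X 1 : MvPolynomial (Fin 3) K) 4 :=
    isWeightedHomogeneous_X K wt3 1
  have x2 : IsWeightedHomogeneous wt3 (X 2 : MvPolynomial (Fin 3) K) 6 :=
    isWeightedHomogeneous_X K wt3 2
  have c (a : K) := isWeightedHomogeneous_C wt3 a
  refine ((hom_mul_pderiv hf ?_).add (hom_mul_pderiv hf ?_)).add (hom_mul_pderiv hf ?_)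
  · have := (c t).mul ((x0.pow 2).sub x1)
    simpa [wt3] using this
  · have := (c (4 * t)).mul ((x0.mul x1).sub x2)
    exact this
  · have := (c (6 * t)).mul ((x0.mul x2).sub (x1.pow 2))
    exact this

lemma DK_iter_hom {K : Type*} [CommRing K] (t : K) (n : ℕ) :
    IsWeightedHomogeneous wt3 ((DK t)^[n] (X 0)) (2 * n + 2) := by
  induction n with
  | zero => exact isWeightedHomogeneous_X K wt3 0
  | succ n ih =>
    rw [Function.iterate_succ_apply']
    exact DK_hom t ih

lemma pderiv_comm3 {K : Type*} [CommRing K] (i j : Fin 3) (f : MvPolynomial (Fin 3) K) :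
    pderiv i (pderiv j f) = pderiv j (pderiv i f) := by
  ext m
  simp only [coeff_pderiv]
  rcases eq_or_ne i j with rfl | h
  · rfl
  · simp [Finsupp.single_apply, h, h.symm, add_right_comm]
    ring

lemma DK_comm {K : Type*} [CommRing K] (t : K) {f : MvPolynomial (Fin 3) K} {w : ℕ}
    (hf : IsWeightedHomogeneous wt3 f w) :
    pderiv 0 (DK t f) = C (t * w) * f + DK t (pderiv 0 f) := by
  have hE := hf.sum_weight_X_mul_pderiv
  have q4 : pderiv 0 (4 : MvPolynomial (Fin 3) K) = 0 := by
    exact_mod_cast (pderiv 0 : Derivation K (MvPolynomial (Fin 3) K) _).map_natCast 4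
  have q6 : pderiv 0 (6 : MvPolynomial (Fin 3) K) = 0 := by
    exact_mod_cast (pderiv 0 : Derivation K (MvPolynomial (Fin 3) K) _).map_natCast 6
  simp [Fin.sum_univ_three, wt3] at hE
  simp only [DK, map_add, Derivation.leibniz, smul_eq_mul, map_sub, pderiv_C, pderiv_X,
    Derivation.leibniz_pow, pderiv_comm3 0 1, pderiv_comm3 0 2, map_mul, map_natCast, map_ofNat]
  simp [q4, q6]
  linear_combination C t * hE

lemma DK_pderiv {K : Type*} [CommRing K] (t : K) (n : ℕ) :
    pderiv 0 ((DK t)^[n + 1] (X 0)) = C (t * ((n + 1) * (n + 2))) * (DK t)^[n] (X 0) := by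
  induction n with
  | zero => 
    rw [Function.iterate_succ_apply', DK_comm t (DK_iter_hom t 0)]
    simp [DK]
  | succ n ih =>
    rw [Function.iterate_succ_apply', DK_comm t (DK_iter_hom t (n + 1)), ih, DK_mul, DK_C,
      zero_mul, zero_add, ← Function.iterate_succ_apply' (DK t), ← add_mul, ← C_add]
    congr 2
    push_cast
    ring

lemma choose_rec (n j : ℕ) :
    (n + 1) * (n + 2) * ((n + 1).choose j * n.descFactorial (min j n)) =
      (j + 1) * ((n + 2).choose (j + 1) * (n + 1).descFactorial (min (j + 1) (n + 1))) := by
  rw [show min (j + 1) (n + 1) = min j n + 1 by omega, Nat.succ_descFactorial_succ]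
  have := Nat.add_one_mul_choose_eq (n + 1) j
  linear_combination (n + 1) * n.descFactorial (min j n) * this

lemma coeff_struct (O : Subring ℚ) (h12 : (1 / 12 : ℚ) ∈ O) (n : ℕ) :
    ∀ m : Fin 3 →₀ ℕ, ∃ r ∈ O, coeff m ((DK (1 / 12 : ℚ))^[n] (X 0)) =
      ((n + 1).choose (m 0) * n.descFactorial (min (m 0) n) : ℕ) * r := by
  have h_mem (n : ℕ) (m : Fin 3 →₀ ℕ) : coeff m ((DK (1 / 12 : ℚ))^[n] (X 0)) ∈ O := by
    have := DK_iter_map O.subtype ⟨1 / 12, h12⟩ n (X 0)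
    rw [map_X] at this
    have h2 : O.subtype ⟨1 / 12, h12⟩ = 1 / 12 := rfl
    rw [h2] at this
    rw [← this, coeff_map]
    exact Subtype.property _
  induction n with
  | zero =>
    intro m
    by_cases h : m 0 ≤ 1
    · refine ⟨_, h_mem 0 m, ?_⟩
      have : (0 + 1).choose (m 0) * Nat.descFactorial 0 (min (m 0) 0) = 1 := by
        interval_cases m 0 <;> rfl
      rw [this]
      simp
    · refine ⟨0, O.zero_mem, ?_⟩
      rw [mul_zero, Function.iterate_zero_apply, coeff_X, if_neg]
      rintro rfl
      simp at h
  | succ n ih =>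
    intro m
    rcases Nat.eq_zero_or_eq_succ_pred (m 0) with h | h
    · refine ⟨_, h_mem (n + 1) m, ?_⟩
      simp [h]
    · set j := (m 0).pred with hj
      obtain ⟨m', hm'⟩ : ∃ m', m = m' + Finsupp.single 0 1 := by
        refine ⟨m - Finsupp.single 0 1, (tsub_add_cancel_of_le ?_).symm⟩
        rw [Finsupp.single_le_iff]
        omega
      have hm0 : m' 0 = j := by
        rw [hm'] at h
        simp at h
        omega
      obtain ⟨r, hr, e⟩ := ih m'
      refine ⟨1 / 12 * r, O.mul_mem h12 hr, ?_⟩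
      have hc := congrArg (coeff m') (DK_pderiv (1 / 12 : ℚ) n)
      rw [coeff_pderiv, coeff_C_mul, ← hm', hm0, e, hm0] at hc
      have hq := congrArg (Nat.cast (R := ℚ)) (choose_rec n j)
      push_cast at hq
      have hj0 : (j : ℚ) + 1 ≠ 0 := by positivity
      rw [h]
      apply mul_right_cancel₀ hj0
      rw [hc]
      push_cast
      simp only [Nat.succ_eq_add_one]
      linear_combination (1 / 12 * r) * hq

lemma coeff_div (O : Subring ℚ) (h12 : (1 / 12 : ℚ) ∈ O) (n : ℕ) (hn : 0 < n)
    (m : Fin 3 →₀ ℕ) (hm : m 0 ≠ 0) :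
    ∃ r ∈ O, coeff m ((DK (1 / 12 : ℚ))^[n] (X 0)) = n * r := by
  obtain ⟨r, hr, e⟩ := coeff_struct O h12 n m
  obtain ⟨k, rfl⟩ : ∃ k, n = k + 1 := ⟨n - 1, by omega⟩
  obtain ⟨s, hs⟩ : ∃ s, min (m 0) (k + 1) = s + 1 := ⟨min (m 0) (k + 1) - 1, by omega⟩
  rw [hs, Nat.succ_descFactorial_succ] at e
  refine ⟨(((k + 1 + 1).choose (m 0) * k.descFactorial s : ℕ) : ℚ) * r,
    O.mul_mem (natCast_mem O _) hr, ?_⟩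
  rw [e]
  push_cast
  ring

lemma ES_const {K : Type*} [CommRing K] (c : ℤ) (j : ℕ) :
    PowerSeries.constantCoeff (ES K c j) = 1 := by
  rw [← PowerSeries.coeff_zero_eq_constantCoeff_apply]
  simp [ES]

lemma ES_one {K : Type*} [CommRing K] (c : ℤ) (j : ℕ) :
    PowerSeries.coeff 1 (ES K c j) = c := by
  simp [ES]

lemma coeff_one_mul' {K : Type*} [CommRing K] (f g : PowerSeries K) :
    PowerSeries.coeff 1 (f * g) = PowerSeries.coeff 1 f * PowerSeries.constantCoeff g +
      PowerSeries.constantCoeff f * PowerSeries.coeff 1 g := by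
  rw [PowerSeries.coeff_mul, Finset.Nat.antidiagonal_succ]
  simp
  ring

lemma poly_inj {k : Type*} [Field k] (v : PowerSeries k)
    (hv0 : PowerSeries.constantCoeff v = 1) (hv1 : v ≠ 1) (F : Polynomial k)
    (hF : Polynomial.aeval v F = 0) : F = 0 := by
  by_contra h
  obtain ⟨q, hq, hd⟩ := Polynomial.exists_eq_pow_rootMultiplicity_mul_and_not_dvd F h 1
  rw [hq, map_mul, map_pow] at hF
  rcases mul_eq_zero.mp hF with h1 | h1
  · have h2 := eq_zero_of_pow_eq_zero h1
    simp at h2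
    exact hv1 (sub_eq_zero.mp h2)
  · rw [Polynomial.dvd_iff_isRoot] at hd
    apply hd
    have h2 := congrArg (PowerSeries.constantCoeff (R := k)) h1
    rw [Polynomial.aeval_def, Polynomial.hom_eval₂, hv0, map_zero] at h2
    have e : (PowerSeries.constantCoeff (R := k)).comp (algebraMap k (PowerSeries k)) =
        RingHom.id k := by
      ext a
      simp
    rw [e] at h2
    exact h2

lemma PhiK_inj {k : Type*} [Field k] (h1728 : (1728 : k) ≠ 0) (w : ℕ)
    (g : MvPolynomial (Fin 3) k) (hg : IsWeightedHomogeneous wt3 g w)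
    (h0 : ∀ m, coeff m g ≠ 0 → m 0 = 0) (hΦ : PhiK k g = 0) : g = 0 := by
  classical
  set e4 := ES k 240 3 with he4
  set e6 := ES k (-504) 5 with he6
  have c4 : PowerSeries.constantCoeff e4 = 1 := ES_const _ _
  have c6 : PowerSeries.constantCoeff e6 = 1 := ES_const _ _
  have inv4 : e4 * e4⁻¹ = 1 := PowerSeries.mul_inv_cancel _ (by rw [c4]; exact one_ne_zero)
  set v := e6 ^ 2 * (e4⁻¹) ^ 3 with hv
  have hve : v * e4 ^ 3 = e6 ^ 2 := by
    rw [hv, mul_assoc, ← mul_pow, mul_comm _ e4, inv4, one_pow, mul_one]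
  have hv0 : PowerSeries.constantCoeff v = 1 := by
    have := congrArg (PowerSeries.constantCoeff (R := k)) hve
    simpa [c4, c6] using this
  have hv1 : v ≠ 1 := by
    intro h
    rw [h, one_mul] at hve
    have := congrArg (PowerSeries.coeff 1) hve
    simp only [pow_succ, pow_zero, one_mul, coeff_one_mul', map_mul, c4, c6] at this
    rw [he4, he6, ES_one, ES_one] at this
    push_cast at this
    apply h1728
    linear_combination this
  have key (m : Fin 3 →₀ ℕ) (hm : coeff m g ≠ 0) : 2 * m 1 + 3 * m 2 = w / 2 ∧ m 0 = 0 := by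
    have h1 := hg hm
    have h2 := h0 m hm
    rw [wt3_apply] at h1
    omega
  set F : Polynomial k := ∑ m ∈ g.support, Polynomial.monomial (m 2 / 2) (coeff m g) with hF
  have hsum : PhiK k g = e4 ^ ((w / 2 - 3 * (w / 2 % 2)) / 2) * e6 ^ (w / 2 % 2) *
      Polynomial.aeval v F := by
    conv_lhs => rw [g.as_sum]
    rw [hF, map_sum, map_sum, Finset.mul_sum]
    refine Finset.sum_congr rfl fun m hm => ?_
    obtain ⟨k1, k2⟩ := key m (mem_support_iff.mp hm)
    rw [PhiK, aeval_monomial, Polynomial.aeval_monomial, Finsupp.prod_fintype _ _ (by simp)]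
    simp only [Fin.prod_univ_three, k2, pow_zero, one_mul]
    have a1 : (w / 2 - 3 * (w / 2 % 2)) / 2 = m 1 + 3 * (m 2 / 2) := by omega
    have a2 : m 2 = w / 2 % 2 + 2 * (m 2 / 2) := by omega
    rw [a1]
    change _ * (e4 ^ m 1 * e6 ^ m 2) = _
    conv_lhs => rw [a2]
    rw [pow_add e4, pow_mul e4, pow_add e6, pow_mul e6, ← hve,
      mul_pow]
    ring
  rw [hΦ] at hsum
  have n4 : e4 ≠ 0 := by intro h; rw [h] at c4; simp at c4
  have n6 : e6 ≠ 0 := by intro h; rw [h] at c6; simp at c6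
  have hF0 := poly_inj v hv0 hv1 F
    ((mul_eq_zero.mp hsum.symm).resolve_left (mul_ne_zero (pow_ne_zero _ n4) (pow_ne_zero _ n6)))
  ext m
  rw [coeff_zero]
  by_contra hm
  have hc := congrArg (fun G => Polynomial.coeff G (m 2 / 2)) hF0
  simp only [hF, Polynomial.finset_sum_coeff, Polynomial.coeff_monomial, Polynomial.coeff_zero] at hc
  rw [Finset.sum_eq_single m] at hc
  · simp [hm] at hc
  · intro b hb hbm
    rw [if_neg]
    intro hbe
    apply hbm
    obtain ⟨k1, k2⟩ := key m hm
    obtain ⟨l1, l2⟩ := key b (mem_support_iff.mp hb)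
    ext i
    fin_cases i <;> simp <;> omega
  · intro hns
    exact absurd (mem_support_iff.mpr hm) hns

/-- The ring of rationals with denominator prime to `p`. -/
def OS (p : ℕ) [Fact p.Prime] : Subring ℚ where
  carrier := {x | (x.den : ZMod p) ≠ 0}
  mul_mem' := by
    intro a b ha hb hc
    rw [ZMod.natCast_eq_zero_iff] at hc
    have := hc.trans (Rat.mul_den_dvd a b)
    rw [← ZMod.natCast_eq_zero_iff, Nat.cast_mul] at this
    exact mul_ne_zero ha hb this
  one_mem' := by simp
  add_mem' := by
    intro a b ha hb hc
    rw [ZMod.natCast_eq_zero_iff] at hc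
    have := hc.trans (Rat.add_den_dvd a b)
    rw [← ZMod.natCast_eq_zero_iff, Nat.cast_mul] at this
    exact mul_ne_zero ha hb this
  zero_mem' := by simp
  neg_mem' := by
    intro a ha
    simpa using ha

lemma mem_OS {p : ℕ} [Fact p.Prime] {x : ℚ} : x ∈ OS p ↔ pInt p x := by
  rw [pInt, ← ZMod.natCast_eq_zero_iff]
  rfl

/-- Reduction modulo `p`. -/
def redOS (p : ℕ) [Fact p.Prime] : OS p →+* ZMod p where
  toFun x := ((x : ℚ) : ZMod p)
  map_one' := by simp
  map_zero' := by simp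
  map_mul' x y := Rat.cast_mul_of_ne_zero x.2 y.2
  map_add' x y := Rat.cast_add_of_ne_zero x.2 y.2

lemma div_mem_OS {p : ℕ} [Fact p.Prime] (a b : ℤ) (hb : (b : ZMod p) ≠ 0) :
    (a / b : ℚ) ∈ OS p := by
  rw [mem_OS, pInt]
  intro h
  apply hb
  rw [ZMod.intCast_zmod_eq_zero_iff_dvd]
  have h2 := Rat.den_dvd a b
  rw [Rat.divInt_eq_div] at h2
  exact (Int.natCast_dvd_natCast.mpr h).trans h2

lemma redOS_eq_zero {p : ℕ} [Fact p.Prime] (x : OS p) (hx : redOS p x = 0) :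
    (p : OS p) ∣ x := by
  have h : (((x : ℚ)) : ZMod p) = 0 := hx
  rw [Rat.cast_def, div_eq_zero_iff] at h
  have h1 := h.resolve_right x.2
  rw [ZMod.intCast_zmod_eq_zero_iff_dvd] at h1
  obtain ⟨k, hk⟩ := h1
  refine ⟨⟨(k / ((x : ℚ).den : ℤ) : ℚ), div_mem_OS _ _ (by rw [Int.cast_natCast]; exact x.2)⟩, ?_⟩
  apply Subtype.ext
  simp only [Subring.coe_mul, Subring.coe_natCast]
  have hd : ((x : ℚ).den : ℚ) ≠ 0 := by exact_mod_cast (x : ℚ).den_nz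
  conv_lhs => rw [← Rat.num_div_den (x : ℚ), hk]
  push_cast
  ring

lemma inv_mem_OS {p : ℕ} [Fact p.Prime] (x : OS p) (hx : redOS p x ≠ 0) :
    ((x : ℚ)⁻¹) ∈ OS p := by
  have h : (((x : ℚ)) : ZMod p) ≠ 0 := hx
  rw [Rat.cast_def] at h
  have h1 : ((x : ℚ).num : ZMod p) ≠ 0 := by
    intro h0
    apply h
    rw [h0, zero_div]
  have := div_mem_OS (p := p) ((x : ℚ).den : ℤ) (x : ℚ).num h1
  rw [← Rat.num_div_den (x : ℚ), inv_div]
  exact_mod_cast this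

lemma exists_lift_OS {p : ℕ} [Fact p.Prime] (f : Poly3) (hf : polyPInt p f) :
    ∃ g : MvPolynomial (Fin 3) (OS p), map (OS p).subtype g = f := by
  have : f ∈ Set.range (map (OS p).subtype) := by
    rw [mem_range_map_iff_coeffs_subset]
    intro c hc
    obtain ⟨m, -, rfl⟩ := mem_coeffs_iff.mp hc
    exact ⟨⟨_, mem_OS.mpr (hf m)⟩, rfl⟩
  exact this

lemma polyPInt_map {p : ℕ} [Fact p.Prime] (g : MvPolynomial (Fin 3) (OS p)) :
    polyPInt p (map (OS p).subtype g) := by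
  intro m
  rw [coeff_map, ← mem_OS]
  exact Subtype.property _

lemma map_red_zero {p : ℕ} [Fact p.Prime] (g : MvPolynomial (Fin 3) (OS p))
    (hg : map (redOS p) g = 0) : ∃ h, g = C (p : OS p) * h := by
  have : C (p : OS p) ∣ g := by
    rw [C_dvd_iff_dvd_coeff]
    intro m
    apply redOS_eq_zero
    rw [← coeff_map, hg, coeff_zero]
  exact this

lemma bern_red (p : ℕ) [Fact p.Prime] (hp5 : 5 ≤ p) :
    ∃ y ∈ OS p, 2 * ((p : ℚ) - 1) / bernoulli (p - 1) = p * y := by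
  have hp : p.Prime := Fact.out
  obtain ⟨k, hk⟩ : ∃ k, p - 1 = 2 * k := by
    obtain ⟨k, hk⟩ := hp.odd_of_ne_two (by omega)
    exact ⟨k, by omega⟩
  obtain ⟨N, hN⟩ := Bernoulli.vonStaudt_clausen k
  have hmem : p ∈ (range (2 * k + 2)).filter (fun q => q.Prime ∧ (q - 1) ∣ 2 * k) := by
    rw [Finset.mem_filter, Finset.mem_range]
    exact ⟨by omega, hp, by rw [hk]⟩
  rw [← Finset.add_sum_erase _ _ hmem] at hN
  set s := ∑ q ∈ ((range (2 * k + 2)).filter (fun q => q.Prime ∧ (q - 1) ∣ 2 * k)).erase p,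
    (1 : ℚ) / q with hs
  have hsO : s ∈ OS p := by
    refine sum_mem fun q hq => ?_
    rw [Finset.mem_erase, Finset.mem_filter, Finset.mem_range] at hq
    have := div_mem_OS (p := p) 1 q (by
      rw [Int.cast_natCast, Ne, ZMod.natCast_eq_zero_iff]
      intro h
      exact hq.1 ((Nat.prime_dvd_prime_iff_eq hp hq.2.2.1).mp h).symm)
    rwa [Int.cast_one, Int.cast_natCast] at this
  have hp0 : (p : ℚ) ≠ 0 := by exact_mod_cast hp.ne_zero
  have hu : (p : ℚ) * bernoulli (p - 1) = p * (N - s) - 1 := by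
    have : bernoulli (p - 1) = N - s - 1 / p := by
      rw [hk]
      linarith
    rw [this]
    field_simp
  let z : OS p := ⟨N - s, sub_mem (intCast_mem _ _) hsO⟩
  let u : OS p := p * z - 1
  have hur : redOS p u = -1 := by
    simp [u]
  have huv : (u : ℚ) = p * bernoulli (p - 1) := by
    rw [hu]
    simp [u, z]
  have hinv := inv_mem_OS u (by rw [hur]; simp)
  refine ⟨2 * (p - 1) * (u : ℚ)⁻¹, ?_, ?_⟩
  · refine mul_mem (mul_mem ?_ (sub_mem (natCast_mem _ _) (one_mem _))) hinv
    exact_mod_cast natCast_mem (OS p) 2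
  · rw [huv, mul_inv]
    field_simp

lemma phi_A_red (p : ℕ) [Fact p.Prime] (hp5 : 5 ≤ p) (A' : MvPolynomial (Fin 3) (OS p))
    (hA : Phi (map (OS p).subtype A') = EAs p) :
    PhiK (ZMod p) (map (redOS p) A') = 1 := by
  rw [Phi_eq, ← PhiK_map] at hA
  rw [← PhiK_map]
  obtain ⟨y, hy, hyp⟩ := bern_red p hp5
  ext n
  have hn := congrArg (PowerSeries.coeff n) hA
  rw [PowerSeries.coeff_map] at hn ⊢
  rw [EAs, PowerSeries.coeff_mk, hyp] at hn
  rw [PowerSeries.coeff_one]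
  split_ifs at hn ⊢ with h
  · have : PowerSeries.coeff n (PhiK (OS p) A') = 1 := Subtype.ext hn
    rw [this, map_one]
  · have : PowerSeries.coeff n (PhiK (OS p) A') =
        -((p : OS p) * ⟨y, hy⟩) * ((∑ d ∈ n.divisors, d ^ (p - 2) : ℕ) : OS p) := by
      apply Subtype.ext
      refine hn.trans ?_
      simp [sigmaQ]
    rw [this]
    simp

lemma f_noP (p : ℕ) [Fact p.Prime] (t : OS p) (ht : (OS p).subtype t = 1 / 12) (e : ℕ) (he : e ≠ 0)
    (m : Fin 3 →₀ ℕ)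
    (hm : coeff m ((DK (redOS p t))^[p ^ e] (X 0)) ≠ 0) : m 0 = 0 := by
  have hp : p.Prime := Fact.out
  by_contra h0
  apply hm
  have h12 : (1 / 12 : ℚ) ∈ OS p := by rw [← ht]; exact t.2
  obtain ⟨r, hr, hc⟩ := coeff_div (OS p) h12 (p ^ e) (pow_pos hp.pos e) m h0
  have h1 := DK_iter_map (OS p).subtype t (p ^ e) (X 0)
  have h2 := DK_iter_map (redOS p) t (p ^ e) (X 0)
  rw [map_X] at h1 h2
  rw [ht] at h1
  rw [← h1, coeff_map] at hc
  rw [← h2, coeff_map]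
  generalize coeff m ((DK t)^[p ^ e] (X 0)) = x at hc ⊢
  have : x = (p : OS p) ^ e * ⟨r, hr⟩ := by
    apply Subtype.ext
    rw [Subring.coe_mul, Subring.coe_pow, Subring.coe_natCast]
    rw [Nat.cast_pow] at hc
    exact hc
  rw [this, map_mul, map_pow, map_natCast, CharP.cast_eq_zero, zero_pow he, zero_mul]

theorem stmt_10 (p : ℕ) (hp : p.Prime) (hp5 : 5 ≤ p)
    (A : Poly3) (hAiso : Isobaric (p - 1) A) (hAnoP : NoP A)
    (hAint : polyPInt p A) (hAPhi : Phi A = EAs p) :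
    ∃ G H : Poly3, polyPInt p G ∧ polyPInt p H ∧
      Dop^[p ^ 2] (X 0 : Poly3) = A ^ (2 * p) * G + (p : Poly3) * H := by
  have : Fact p.Prime := ⟨hp⟩
  have n2 : ((2 : ℕ) : ZMod p) ≠ 0 := by
    rw [Ne, ZMod.natCast_eq_zero_iff]
    intro h
    have := Nat.le_of_dvd (by norm_num) h
    omega
  have n3 : ((3 : ℕ) : ZMod p) ≠ 0 := by
    rw [Ne, ZMod.natCast_eq_zero_iff]
    intro h
    have := Nat.le_of_dvd (by norm_num) h
    omega
  push_cast at n2 n3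
  have h12 : (1 / 12 : ℚ) ∈ OS p := by
    have := div_mem_OS (p := p) 1 12 (by
      have : ((12 : ℤ) : ZMod p) = 2 ^ 2 * 3 := by norm_num
      rw [this]
      exact mul_ne_zero (pow_ne_zero _ n2) n3)
    rwa [Int.cast_one, Int.cast_ofNat] at this
  have h1728 : (1728 : ZMod p) ≠ 0 := by
    have : (1728 : ZMod p) = 2 ^ 6 * 3 ^ 3 := by norm_num
    rw [this]
    exact mul_ne_zero (pow_ne_zero _ n2) (pow_ne_zero _ n3)
  obtain ⟨A', hA'⟩ := exists_lift_OS A hAint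
  rw [← hA'] at hAPhi
  have hΦA := phi_A_red p hp5 A' hAPhi
  obtain ⟨t, ht12⟩ : ∃ t : OS p, (OS p).subtype t = 1 / 12 := ⟨⟨1 / 12, h12⟩, rfl⟩
  obtain ⟨s, hs⟩ : ∃ s, s = redOS p t := ⟨_, rfl⟩
  have ht : 12 * t = 1 := by
    apply Subtype.ext
    have : ((12 : OS p) : ℚ) = 12 := rfl
    have h' : (t : ℚ) = 1 / 12 := ht12
    rw [Subring.coe_mul, this, h', Subring.coe_one]
    norm_num
  have hst : 12 * s = 1 := by
    have := congrArg (redOS p) ht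
    rwa [map_mul, map_one, map_ofNat, ← hs] at this
  set B := map (redOS p) A' with hB
  have hcB (m : Fin 3 →₀ ℕ) (hm : coeff m B ≠ 0) : coeff m A ≠ 0 := by
    intro h0
    apply hm
    rw [hB, coeff_map]
    rw [← hA', coeff_map] at h0
    have : coeff m A' = 0 := Subtype.ext h0
    rw [this, map_zero]
  have hBhom : IsWeightedHomogeneous wt3 B (p - 1) := by
    intro m hm
    rw [wt3_apply]
    exact hAiso m (mem_support_iff.mpr (hcB m hm))
  have hB0 : IsWeightedHomogeneous (![1, 0, 0] : Fin 3 → ℕ) B 0 := by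
    intro m hm
    have := hAnoP m (mem_support_iff.mpr (hcB m hm))
    rw [Finsupp.weight_apply, Finsupp.sum_fintype _ _ (by simp)]
    simp [Fin.sum_univ_three, this]
  have hf0 (e : ℕ) (he : e ≠ 0) :
      IsWeightedHomogeneous (![1, 0, 0] : Fin 3 → ℕ) ((DK s)^[p ^ e] (X 0)) 0 := by
    intro m hm
    rw [hs] at hm
    have := f_noP p t ht12 e he m hm
    rw [Finsupp.weight_apply, Finsupp.sum_fintype _ _ (by simp)]
    simp [Fin.sum_univ_three, this]
  have key : (DK s)^[p ^ 2] (X 0) - B ^ (2 * p) * (DK s)^[p ^ 1] (X 0) = 0 := by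
    apply PhiK_inj h1728 (2 * p ^ 2 + 2)
    · refine (DK_iter_hom s (p ^ 2)).sub ?_
      have := (hBhom.pow (2 * p)).mul (DK_iter_hom s (p ^ 1))
      have e : (2 * p) • (p - 1) + (2 * p ^ 1 + 2) = 2 * p ^ 2 + 2 := by
        obtain ⟨k, rfl⟩ : ∃ k, p = k + 1 := ⟨p - 1, by omega⟩
        simp only [smul_eq_mul, Nat.add_sub_cancel]
        ring
      rwa [e] at this
    · intro m hm
      have h1 := (hB0.pow (2 * p)).mul (hf0 1 one_ne_zero)
      rw [smul_zero, add_zero] at h1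
      have h2 := ((hf0 2 two_ne_zero).sub h1) hm
      rw [Finsupp.weight_apply, Finsupp.sum_fintype _ _ (by simp)] at h2
      simpa [Fin.sum_univ_three] using h2
    · rw [map_sub, map_mul, map_pow, hΦA, one_pow, one_mul, PhiK_D_iter s hst,
        PhiK_D_iter s hst, sub_eq_zero]
      ext n
      rw [thetaPS_iter_coeff, thetaPS_iter_coeff, pow_one, sq, pow_mul, ZMod.pow_card]
  have hlift : map (redOS p) ((DK t)^[p ^ 2] (X 0) - A' ^ (2 * p) * (DK t)^[p ^ 1] (X 0)) = 0 := by
    rw [map_sub, map_mul, map_pow, DK_iter_map, DK_iter_map, map_X, ← hs]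
    exact key
  obtain ⟨H, hH⟩ := map_red_zero _ hlift
  refine ⟨map (OS p).subtype ((DK t)^[p ^ 1] (X 0)), map (OS p).subtype H, polyPInt_map _,
    polyPInt_map _, ?_⟩
  have h3 := congrArg (map (OS p).subtype) hH
  rw [map_sub, map_mul, map_pow, map_mul, map_C, hA', map_natCast, map_natCast] at h3
  have h4 := DK_iter_map (OS p).subtype t (p ^ 2) (X 0)
  rw [map_X] at h4
  rw [ht12] at h4
  rw [Dop_eq, ← h4]
  linear_combination h3
end
end

section
/- Let p ≥ 5 be a prime, let k be a positive integer, let F ∈ ℤ_(p)[Q,R] be isobaric of weight k and not involving P, and let n be the unique integer with 0 ≤ np²−k+1 < p². Then D^{np²−k+1}F is congruent to a modular form modulo p²; precisely, there exists a polynomial G ∈ ℤ_(p)[Q,R], isobaric of weight 2np²−k+2 and not involving P, such that D^{np²−k+1}F − G ∈ p²·ℤ_(p)[P,Q,R]. -/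
open MvPolynomial Finset

noncomputable section

lemma pInt_add {p : ℕ} (hp : p.Prime) {x y : ℚ} (hx : pInt p x) (hy : pInt p y) :
    pInt p (x + y) := fun h =>
  ((hp.dvd_mul).1 (h.trans (Rat.add_den_dvd x y))).elim hx hy

lemma pInt_mul {p : ℕ} (hp : p.Prime) {x y : ℚ} (hx : pInt p x) (hy : pInt p y) :
    pInt p (x * y) := fun h =>
  ((hp.dvd_mul).1 (h.trans (Rat.mul_den_dvd x y))).elim hx hy

lemma pInt_int {p : ℕ} (hp : p.Prime) (z : ℤ) : pInt p (z : ℚ) := by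
  simpa [pInt] using hp.one_lt.ne'

lemma pInt_nat {p : ℕ} (hp : p.Prime) (z : ℕ) : pInt p (z : ℚ) := by
  simpa [pInt] using hp.one_lt.ne'

lemma pInt_zero {p : ℕ} (hp : p.Prime) : pInt p 0 := by
  simpa using pInt_nat hp 0

lemma pInt_twelfth {p : ℕ} (hp : p.Prime) (hp5 : 5 ≤ p) : pInt p (1/12 : ℚ) := by
  have h : (1/12 : ℚ).den = 12 := by norm_num
  intro h'
  rw [h, show 12 = 2 * (2 * 3) from rfl, hp.dvd_mul, hp.dvd_mul] at h'
  rcases h' with h' | h' | h'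
  all_goals have := Nat.le_of_dvd (by norm_num) h'; omega

lemma pInt_div {p : ℕ} (hp : p.Prime) (hp5 : 5 ≤ p) (z : ℤ) {x : ℚ} (hx : pInt p x) :
    pInt p (x * (z * (1/12))) :=
  pInt_mul hp hx (pInt_mul hp (pInt_int hp z) (pInt_twelfth hp hp5))

lemma pInt_sum {p : ℕ} (hp : p.Prime) {ι : Type*} (s : Finset ι) (f : ι → ℚ)
    (h : ∀ i ∈ s, pInt p (f i)) : pInt p (∑ i ∈ s, f i) :=
  Finset.sum_induction f (pInt p) (fun _ _ => pInt_add hp) (pInt_zero hp) h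

lemma polyPInt_add {p : ℕ} (hp : p.Prime) {f g : Poly3} (hf : polyPInt p f)
    (hg : polyPInt p g) : polyPInt p (f + g) := fun m => by
  rw [coeff_add]; exact pInt_add hp (hf m) (hg m)

lemma polyPInt_zero {p : ℕ} (hp : p.Prime) : polyPInt p 0 := fun m => by
  rw [coeff_zero]; exact pInt_zero hp

lemma polyPInt_mul {p : ℕ} (hp : p.Prime) {f g : Poly3} (hf : polyPInt p f)
    (hg : polyPInt p g) : polyPInt p (f * g) := fun m => by
  rw [coeff_mul]; exact pInt_sum hp _ _ fun i _ => pInt_mul hp (hf _) (hg _)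

lemma polyPInt_monomial {p : ℕ} (hp : p.Prime) (m : Fin 3 →₀ ℕ) {c : ℚ} (hc : pInt p c) :
    polyPInt p (monomial m c) := fun m' => by
  rw [coeff_monomial]; split_ifs
  · exact hc
  · exact pInt_zero hp

lemma polyPInt_C {p : ℕ} (hp : p.Prime) {c : ℚ} (hc : pInt p c) :
    polyPInt p (C c) := polyPInt_monomial hp 0 hc

lemma polyPInt_pow {p : ℕ} (hp : p.Prime) {f : Poly3} (hf : polyPInt p f) (n : ℕ) :
    polyPInt p (f ^ n) := by
  induction n with
  | zero => rw [pow_zero, ← C_1]; exact polyPInt_C hp (by simpa using pInt_nat hp 1)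
  | succ n ih => rw [pow_succ]; exact polyPInt_mul hp ih hf

lemma polyPInt_sum {p : ℕ} (hp : p.Prime) {ι : Type*} (s : Finset ι) (f : ι → Poly3)
    (h : ∀ i ∈ s, polyPInt p (f i)) : polyPInt p (∑ i ∈ s, f i) :=
  Finset.sum_induction f (polyPInt p) (fun _ _ => polyPInt_add hp) (polyPInt_zero hp) h

/-- `p`-integral, isobaric, and free of `P`. -/
def Good (p w : ℕ) (f : Poly3) : Prop :=
  ∀ m, pInt p (coeff m f) ∧ (coeff m f ≠ 0 → m 0 = 0 ∧ 2 * m 0 + 4 * m 1 + 6 * m 2 = w)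

lemma Good.add {p w : ℕ} (hp : p.Prime) {f g : Poly3} (hf : Good p w f) (hg : Good p w g) :
    Good p w (f + g) := fun m => by
  rw [coeff_add]
  refine ⟨pInt_add hp (hf m).1 (hg m).1, fun h => ?_⟩
  by_cases h0 : coeff m f = 0
  · rw [h0, zero_add] at h; exact (hg m).2 h
  · exact (hf m).2 h0

lemma Good.zero {p w : ℕ} (hp : p.Prime) : Good p w 0 := fun m => by
  rw [coeff_zero]; exact ⟨pInt_zero hp, fun h => (h rfl).elim⟩

lemma Good.monomial {p w : ℕ} (hp : p.Prime) (m : Fin 3 →₀ ℕ) {c : ℚ} (hc : pInt p c)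
    (h : c ≠ 0 → m 0 = 0 ∧ 2 * m 0 + 4 * m 1 + 6 * m 2 = w) :
    Good p w (monomial m c) := fun m' => by
  rw [coeff_monomial]; split_ifs with h'
  · subst h'; exact ⟨hc, h⟩
  · exact ⟨pInt_zero hp, fun h => (h rfl).elim⟩

lemma Good.map {p w w' : ℕ} (hp : p.Prime) (L : Poly3 →ₗ[ℚ] Poly3)
    (hL : ∀ m c, pInt p c → m 0 = 0 → 2 * m 0 + 4 * m 1 + 6 * m 2 = w →
      Good p w' (L (MvPolynomial.monomial m c))) {f : Poly3} (hf : Good p w f) :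
    Good p w' (L f) := by
  rw [f.as_sum, map_sum]
  refine Finset.sum_induction _ (Good p w') (fun _ _ => Good.add hp) (Good.zero hp) ?_
  intro m hm
  have := (hf m).2 (mem_support_iff.1 hm)
  exact hL m _ (hf m).1 this.1 this.2

/-- The Serre derivative on polynomials free of `P`. -/
def serreD : Poly3 →ₗ[ℚ] Poly3 where
  toFun f := C (-1/3 : ℚ) * X 2 * pderiv 1 f + C (-1/2 : ℚ) * X 1 ^ 2 * pderiv 2 f
  map_add' f g := by simp only [map_add]; ring
  map_smul' c f := by
    rw [Derivation.map_smul, Derivation.map_smul]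
    simp only [RingHom.id_apply, MvPolynomial.smul_eq_C_mul]; ring

lemma serreD_apply (f : Poly3) :
    serreD f = C (-1/3 : ℚ) * X 2 * pderiv 1 f + C (-1/2 : ℚ) * X 1 ^ 2 * pderiv 2 f := rfl

/-- Multiplication by `c Q`. -/
def mulQ (c : ℚ) : Poly3 →ₗ[ℚ] Poly3 where
  toFun f := C c * X 1 * f
  map_add' f g := by ring
  map_smul' c f := by
    simp only [RingHom.id_apply, MvPolynomial.smul_eq_C_mul]; ring

lemma mulQ_apply (c : ℚ) (f : Poly3) : mulQ c f = C c * X 1 * f := rfl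

lemma Good.serreD {p w : ℕ} (hp : p.Prime) (hp5 : 5 ≤ p) {f : Poly3} (hf : Good p w f) :
    Good p (w + 2) (serreD f) := by
  refine hf.map hp _ fun m c hc h0 hw => ?_
  rw [serreD_apply, pderiv_monomial, pderiv_monomial]
  have e1 : (C (-1/3 : ℚ) * X 2 * MvPolynomial.monomial (m - Finsupp.single 1 1) (c * m 1) : Poly3)
      = MvPolynomial.monomial (Finsupp.single 2 1 + (m - Finsupp.single 1 1))
          (c * (((-4 * m 1 : ℤ) : ℚ) * (1/12))) := by
    rw [X, C_mul_monomial, monomial_mul]; congr 1; push_cast; ring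
  have e2 : (C (-1/2 : ℚ) * X 1 ^ 2 * MvPolynomial.monomial (m - Finsupp.single 2 1) (c * m 2) : Poly3)
      = MvPolynomial.monomial (Finsupp.single 1 2 + (m - Finsupp.single 2 1))
          (c * (((-6 * m 2 : ℤ) : ℚ) * (1/12))) := by
    rw [X_pow_eq_monomial, C_mul_monomial, monomial_mul]; congr 1; push_cast; ring
  rw [e1, e2]
  refine Good.add hp (Good.monomial hp _ (pInt_div hp hp5 _ hc) fun h => ?_)
    (Good.monomial hp _ (pInt_div hp hp5 _ hc) fun h => ?_)
  · have : m 1 ≠ 0 := by rintro h'; simp [h'] at h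
    simp [Finsupp.single_apply, h0]; omega
  · have : m 2 ≠ 0 := by rintro h'; simp [h'] at h
    simp [Finsupp.single_apply, h0]; omega

lemma Good.mulQ {p w : ℕ} (hp : p.Prime) {c : ℚ} (hc : pInt p c) {f : Poly3}
    (hf : Good p w f) : Good p (w + 4) (mulQ c f) := by
  refine hf.map hp _ fun m d hd h0 hw => ?_
  rw [mulQ_apply, X, C_mul_monomial, monomial_mul]
  refine Good.monomial hp _ (pInt_mul hp (pInt_mul hp hc (by simpa using pInt_nat hp 1)) hd)
    fun h => ?_
  simp [Finsupp.single_apply, h0]; omega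

lemma Dop_add (f g : Poly3) : Dop (f + g) = Dop f + Dop g := by
  simp only [Dop, map_add]; ring

lemma Dop_mul (f g : Poly3) : Dop (f * g) = f * Dop g + g * Dop f := by
  simp only [Dop, Derivation.leibniz, smul_eq_mul]; ring

lemma Dop_C (c : ℚ) : Dop (C c) = 0 := by simp [Dop]

lemma Dop_zero : Dop 0 = 0 := by simp [Dop]

lemma Dop_sum {ι : Type*} (s : Finset ι) (f : ι → Poly3) :
    Dop (∑ i ∈ s, f i) = ∑ i ∈ s, Dop (f i) :=
  map_sum (⟨⟨Dop, Dop_zero⟩, Dop_add⟩ : Poly3 →+ Poly3) f s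

/-- `P / 12`. -/
def Yp : Poly3 := C (1/12 : ℚ) * X 0

lemma Dop_Y : Dop Yp = Yp ^ 2 - C (1/144 : ℚ) * X 1 := by
  have h : (C (1/144 : ℚ) : Poly3) = C (1/12) * C (1/12) := by rw [← C_mul]; norm_num
  rw [Yp, Dop_mul, Dop_C, h]
  simp [Dop, pderiv_X, Pi.single_apply]
  ring

lemma Dop_Y_pow (j : ℕ) : Dop (Yp ^ j) =
    (j : Poly3) * Yp ^ (j + 1) - (j : Poly3) * (C (1/144 : ℚ) * X 1) * Yp ^ (j - 1) := by
  induction j with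
  | zero => simp [Dop]
  | succ j ih =>
    rw [pow_succ, Dop_mul, ih, Dop_Y]
    rcases j with _ | j
    · simp
    · simp only [Nat.add_sub_cancel]; push_cast; ring

lemma Dop_good {p w : ℕ} (hp : p.Prime) {f : Poly3} (hf : Good p w f) :
    Dop f = serreD f + (w : Poly3) * (Yp * f) := by
  rw [f.as_sum, Dop_sum, map_sum, Finset.mul_sum, Finset.mul_sum, ← Finset.sum_add_distrib]
  refine Finset.sum_congr rfl fun m hm => ?_
  obtain ⟨h0, hw⟩ := (hf m).2 (mem_support_iff.1 hm)
  generalize coeff m f = c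
  have e0 : pderiv 0 (monomial m c : Poly3) = 0 := by rw [pderiv_monomial]; simp [h0]
  have e1 : X 1 * pderiv 1 (monomial m c : Poly3) = (m 1 : Poly3) * monomial m c := by
    rw [X_mul_pderiv_monomial, nsmul_eq_mul]
  have e2 : X 2 * pderiv 2 (monomial m c : Poly3) = (m 2 : Poly3) * monomial m c := by
    rw [X_mul_pderiv_monomial, nsmul_eq_mul]
  have hw' : (w : Poly3) = 4 * (m 1 : Poly3) + 6 * (m 2 : Poly3) := by
    rw [← hw, h0]; push_cast; ring
  rw [Dop, serreD_apply, e0, hw', Yp]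
  have c1 : (C (1/3 : ℚ) : Poly3) = 4 * C (1/12) := by
    rw [show (4 : Poly3) = C 4 from rfl, ← C_mul]; norm_num
  have c2 : (C (1/2 : ℚ) : Poly3) = 6 * C (1/12) := by
    rw [show (6 : Poly3) = C 6 from rfl, ← C_mul]; norm_num
  have c3 : (C (-1/3 : ℚ) : Poly3) = -C (1/3) := by rw [← C_neg]; norm_num
  have c4 : (C (-1/2 : ℚ) : Poly3) = -C (1/2) := by rw [← C_neg]; norm_num
  rw [c3, c4, c1, c2]
  linear_combination (4 * C (1/12) * X 0) * e1 + (6 * C (1/12) * X 0) * e2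

/-- The sequence of modified Serre derivatives. -/
def Vs (k : ℕ) (F : Poly3) : ℕ → Poly3
  | 0 => F
  | 1 => serreD F
  | (r + 2) => serreD (Vs k F (r + 1)) +
      mulQ (((-((r + 1) * (r + k)) : ℤ) : ℚ) * ((1/12) * (1/12))) (Vs k F r)

lemma Vs_good {p k : ℕ} (hp : p.Prime) (hp5 : 5 ≤ p) {F : Poly3} (hF : Good p k F) (r : ℕ) :
    Good p (k + 2 * r) (Vs k F r) := by
  induction r using Nat.strong_induction_on with
  | _ r ih =>
    match r with
    | 0 => exact hF
    | 1 => exact hF.serreD hp hp5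
    | r + 2 =>
      rw [Vs]
      exact Good.add hp ((ih (r + 1) (by omega)).serreD hp hp5)
        ((ih r (by omega)).mulQ hp (pInt_mul hp (pInt_int hp _)
          (pInt_mul hp (pInt_twelfth hp hp5) (pInt_twelfth hp hp5))))

lemma Dop_Vs_zero {p k : ℕ} (hp : p.Prime) (hp5 : 5 ≤ p) {F : Poly3} (hF : Good p k F) :
    Dop (Vs k F 0) = Vs k F 1 + (k : Poly3) * (Yp * Vs k F 0) := by
  rw [Dop_good hp (Vs_good hp hp5 hF 0)]; simp [Vs]

lemma Dop_Vs_succ {p k : ℕ} (hp : p.Prime) (hp5 : 5 ≤ p) {F : Poly3} (hF : Good p k F)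
    (r : ℕ) :
    Dop (Vs k F (r + 1)) = Vs k F (r + 2) + ((k + 2 * (r + 1) : ℕ) : Poly3) * (Yp * Vs k F (r + 1))
      + (((r + 1) * (r + k) : ℕ) : Poly3) * (C (1/144 : ℚ) * X 1) * Vs k F r := by
  rw [Dop_good hp (Vs_good hp hp5 hF (r + 1)), Vs, mulQ_apply]
  have : (C (((-((r + 1) * (r + k)) : ℤ) : ℚ) * ((1/12) * (1/12))) : Poly3)
      = - ((((r + 1) * (r + k) : ℕ) : Poly3) * C (1/144 : ℚ)) := by
    rw [← map_natCast (C : ℚ →+* Poly3), ← C_mul, ← C_neg]; congr 1; push_cast; ring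
  rw [this]; ring

/-- The coefficients. -/
def aco (k r j : ℕ) : ℕ := (r + j).choose r * (k + r).ascFactorial j

lemma aco_eq (k r j : ℕ) : (aco (k + 1) r j : ℚ) =
    (r + j).factorial * (k + r + j).factorial / (r.factorial * j.factorial * (k + r).factorial) := by
  have h1 : (r.factorial * j.factorial * (r + j).choose r : ℚ) = (r + j).factorial := by
    have := Nat.add_choose_mul_factorial_mul_factorial r j
    rw [← this, Nat.choose_symm_add]; push_cast; ring
  have h2 : ((k + r).factorial * (k + 1 + r).ascFactorial j : ℚ) = (k + r + j).factorial := by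
    have := Nat.factorial_mul_ascFactorial (k + r) j
    rw [← this, show k + 1 + r = k + r + 1 by ring]; push_cast; ring
  rw [← h1, ← h2, aco]
  have := Nat.factorial_ne_zero r
  have := Nat.factorial_ne_zero j
  have := Nat.factorial_ne_zero (k + r)
  field_simp
  push_cast; ring

lemma aco_cancel (k r j : ℕ) :
    (j + 1) * aco (k + 1) r (j + 1) = (r + 1) * (r + (k + 1)) * aco (k + 1) (r + 1) j := by
  have : ((j + 1) * aco (k + 1) r (j + 1) : ℚ)
      = (r + 1) * (r + (k + 1)) * aco (k + 1) (r + 1) j := by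
    rw [aco_eq, aco_eq]
    have h1 : r + 1 + j = r + j + 1 := by ring
    have h2 : r + (j + 1) = r + j + 1 := by ring
    have h3 : k + (r + 1) + j = k + r + j + 1 := by ring
    have h4 : k + r + (j + 1) = k + r + j + 1 := by ring
    have h5 : k + (r + 1) = k + r + 1 := by ring
    rw [h1, h2, h3, h4, h5]
    simp only [Nat.factorial_succ]
    push_cast
    field_simp
    ring
  exact_mod_cast this

lemma aco_zero_right (k r : ℕ) : aco k r 0 = 1 := by simp [aco]

lemma aco_zero_left (k j : ℕ) : aco k 0 (j + 1) = (j + k) * aco k 0 j := by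
  simp [aco, Nat.ascFactorial_succ, add_comm]

lemma aco_rec (k r j : ℕ) : aco (k + 1) (r + 1) (j + 1) =
    aco (k + 1) r (j + 1) + (j + (k + 1) + 2 * (r + 1)) * aco (k + 1) (r + 1) j := by
  have : (aco (k + 1) (r + 1) (j + 1) : ℚ) =
    aco (k + 1) r (j + 1) + (j + (k + 1) + 2 * (r + 1)) * aco (k + 1) (r + 1) j := by
    rw [aco_eq, aco_eq, aco_eq]
    have h0 : r + 1 + (j + 1) = r + j + 1 + 1 := by ring
    have h1 : r + 1 + j = r + j + 1 := by ring
    have h2 : r + (j + 1) = r + j + 1 := by ring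
    have h3 : k + (r + 1) + j = k + r + j + 1 := by ring
    have h4 : k + r + (j + 1) = k + r + j + 1 := by ring
    have h6 : k + (r + 1) + (j + 1) = k + r + j + 1 + 1 := by ring
    have h5 : k + (r + 1) = k + r + 1 := by ring
    rw [h0, h1, h2, h3, h6, h4, h5]
    simp only [Nat.factorial_succ]
    push_cast
    field_simp
    ring
  exact_mod_cast this

/-- Contribution to `b1`. -/
def b1 (k : ℕ) : ℕ → ℕ → ℕ
  | 0, _ => 0
  | r + 1, j => aco k r j

/-- Contribution to `b2`. -/
def b2 (k : ℕ) : ℕ → ℕ → ℕ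
  | _, 0 => 0
  | r, j + 1 => (j + k + 2 * r) * aco k r j

lemma aco_split (k m : ℕ) (x : ℕ × ℕ) (hx : x ∈ antidiagonal (m + 1)) :
    aco (k + 1) x.1 x.2 = b1 (k + 1) x.1 x.2 + b2 (k + 1) x.1 x.2 := by
  rw [HasAntidiagonal.mem_antidiagonal] at hx
  obtain ⟨r, j⟩ := x
  rcases r with _ | r <;> rcases j with _ | j
  · simp at hx
  · simp [b1, b2, aco_zero_left]
  · simp [b1, b2, aco_zero_right]
  · simp only [b1, b2]; exact aco_rec k r j

/-- The `q`-part from the Serre derivative. -/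
def t1 (k : ℕ) (F : Poly3) : ℕ → Poly3
  | 0 => 0
  | r + 1 => (((r + 1) * (r + k) : ℕ) : Poly3) * (C (1/144 : ℚ) * X 1) * Vs k F r

lemma Dop_term {p k : ℕ} (hp : p.Prime) (hp5 : 5 ≤ p) {F : Poly3} (hF : Good p k F)
    (a r j : ℕ) : Dop ((a : Poly3) * (Yp ^ j * Vs k F r)) =
      (a : Poly3) * (Yp ^ j * Vs k F (r + 1))
      + (((j + k + 2 * r) * a : ℕ) : Poly3) * (Yp ^ (j + 1) * Vs k F r)
      + ((a : Poly3) * (Yp ^ j * t1 k F r)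
      - ((j * a : ℕ) : Poly3) * ((C (1/144 : ℚ) * X 1) * (Yp ^ (j - 1) * Vs k F r))) := by
  rw [Dop_mul, Dop_mul, Dop_Y_pow, ← map_natCast (C : ℚ →+* Poly3) a, Dop_C]
  rcases r with _ | r
  · rw [Dop_Vs_zero hp hp5 hF, t1]; push_cast; simp only [map_natCast]; ring
  · rw [Dop_Vs_succ hp hp5 hF, t1]; push_cast; simp only [map_natCast]; ring

lemma Dop_iter {p k : ℕ} (hp : p.Prime) (hp5 : 5 ≤ p) {F : Poly3} (hF : Good p (k + 1) F)
    (m : ℕ) : Dop^[m] F = ∑ x ∈ antidiagonal m,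
      (aco (k + 1) x.1 x.2 : Poly3) * (Yp ^ x.2 * Vs (k + 1) F x.1) := by
  induction m with
  | zero => simp [aco, Vs]
  | succ m ih =>
    rw [Function.iterate_succ_apply', ih, Dop_sum]
    simp only [Dop_term hp hp5 hF]
    rw [Finset.sum_add_distrib, Finset.sum_add_distrib]
    have hz : ∑ x ∈ antidiagonal m, ((aco (k + 1) x.1 x.2 : Poly3) * (Yp ^ x.2 * t1 (k + 1) F x.1)
      - ((x.2 * aco (k + 1) x.1 x.2 : ℕ) : Poly3) *
        ((C (1/144 : ℚ) * X 1) * (Yp ^ (x.2 - 1) * Vs (k + 1) F x.1))) = 0 := by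
      rcases m with _ | m
      · simp [t1]
      · rw [Finset.sum_sub_distrib, Finset.Nat.sum_antidiagonal_succ,
          Finset.Nat.sum_antidiagonal_succ']
        simp only [t1, Nat.add_sub_cancel, aco_cancel]
        rw [sub_eq_zero]
        simp only [mul_zero, zero_mul, zero_add, Nat.cast_zero]
        refine Finset.sum_congr rfl fun x _ => ?_
        push_cast; ring
    rw [hz, add_zero]
    symm
    rw [Finset.sum_congr rfl (fun x hx => by rw [aco_split k m x hx, Nat.cast_add, add_mul])]
    rw [Finset.sum_add_distrib, Finset.Nat.sum_antidiagonal_succ]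
    congr 1
    · simp [b1]
    · rw [Finset.Nat.sum_antidiagonal_succ']
      simp [b2]

lemma Yp_pInt {p : ℕ} (hp : p.Prime) (hp5 : 5 ≤ p) : polyPInt p Yp :=
  polyPInt_mul hp (polyPInt_C hp (pInt_twelfth hp hp5))
    (polyPInt_monomial hp _ (by simpa using pInt_nat hp 1))

theorem stmt_11 (p : ℕ) (hp : p.Prime) (hp5 : 5 ≤ p)
    (k : ℕ) (hk : 0 < k) (F : Poly3) (hFiso : Isobaric k F) (hFnoP : NoP F)
    (hFint : polyPInt p F)
    (n : ℕ) (hn1 : (k : ℤ) ≤ n * p ^ 2 + 1) (hn2 : (n * p ^ 2 + 1 : ℤ) - k < p ^ 2) :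
    ∃ G H : Poly3, Isobaric (2 * n * p ^ 2 + 2 - k) G ∧ NoP G ∧ polyPInt p G ∧
      polyPInt p H ∧ Dop^[n * p ^ 2 + 1 - k] F - G = (p : Poly3) ^ 2 * H := by
  have hF : Good p k F := fun m => ⟨hFint m, fun h =>
    ⟨hFnoP m (mem_support_iff.2 h), hFiso m (mem_support_iff.2 h)⟩⟩
  obtain ⟨k, rfl⟩ : ∃ k', k = k' + 1 := ⟨k - 1, by omega⟩
  have hn1' : k + 1 ≤ n * p ^ 2 + 1 := by exact_mod_cast hn1
  obtain ⟨m, hm⟩ : ∃ m, n * p ^ 2 = k + m := ⟨n * p ^ 2 - k, by omega⟩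
  have e1 : n * p ^ 2 + 1 - (k + 1) = m := by omega
  have e2 : 2 * n * p ^ 2 + 2 - (k + 1) = k + 1 + 2 * m := by
    rw [mul_assoc, hm]; omega
  rw [e1, e2]
  have hG := Vs_good hp hp5 hF m
  have hdiv : ∀ x ∈ antidiagonal m, x.2 ≠ 0 → ∃ b : ℕ, aco (k + 1) x.1 x.2 = p ^ 2 * b := by
    rintro ⟨r, j⟩ hx hj
    rw [HasAntidiagonal.mem_antidiagonal] at hx
    obtain ⟨j, rfl⟩ := Nat.exists_eq_succ_of_ne_zero hj
    simp only [Nat.succ_eq_add_one] at hx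
    refine ⟨n * ((r + (j + 1)).choose r * (k + 1 + r).ascFactorial j), ?_⟩
    simp only [aco, Nat.succ_eq_add_one]
    rw [Nat.ascFactorial_succ, show k + 1 + r + j = n * p ^ 2 by omega]
    ring
  refine ⟨Vs (k + 1) F m, ∑ x ∈ (antidiagonal m).filter (fun x => x.2 ≠ 0),
    ((aco (k + 1) x.1 x.2 / p ^ 2 : ℕ) : Poly3) * (Yp ^ x.2 * Vs (k + 1) F x.1),
    fun i hi => ((hG i).2 (mem_support_iff.1 hi)).2,
    fun i hi => ((hG i).2 (mem_support_iff.1 hi)).1, fun i => (hG i).1, ?_, ?_⟩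
  · refine polyPInt_sum hp _ _ fun x _ => ?_
    rw [← map_natCast (C : ℚ →+* Poly3)]
    exact polyPInt_mul hp (polyPInt_C hp (pInt_nat hp _)) (polyPInt_mul hp
      (polyPInt_pow hp (Yp_pInt hp hp5) _) fun i => (Vs_good hp hp5 hF _ i).1)
  · rw [Dop_iter hp hp5 hF, Finset.mul_sum,
      ← Finset.sum_filter_add_sum_filter_not _ (fun x : ℕ × ℕ => x.2 ≠ 0)]
    have h0 : (antidiagonal m).filter (fun x : ℕ × ℕ => ¬ x.2 ≠ 0) = {(m, 0)} := by
      ext ⟨a, b⟩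
      simp only [mem_filter, HasAntidiagonal.mem_antidiagonal, mem_singleton, Prod.mk.injEq]
      omega
    rw [h0, Finset.sum_singleton]
    simp only [aco_zero_right, pow_zero, Nat.cast_one, one_mul, add_sub_cancel_right]
    refine Finset.sum_congr rfl fun x hx => ?_
    rw [mem_filter] at hx
    obtain ⟨b, hb⟩ := hdiv x hx.1 hx.2
    rw [hb, Nat.mul_div_cancel_left _ (pow_pos hp.pos 2)]
    push_cast; ring
end
end
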